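/- Let a(𝐳), b(𝐳) be local homogeneous End(E)-valued distributions, and let {c^i(𝐳,𝐰), 𝐡_i}_{1≤i≤r} and {d^j(𝐳,𝐰), 𝐠_j}_{1≤j≤s} be two OPEs of a, b. Then for every 𝐧=(n,n̄)∈K²: Σ_{i=1}^r ∂_z^{(h_i−1−n)}∂_z̄^{(h̄_i−1−n̄)} c^i(𝐳,𝐰)|_{𝐳=𝐰} = Σ_{j=1}^s ∂_z^{(g_j−1−n)}∂_z̄^{(ḡ_j−1−n̄)} d^j(𝐳,𝐰)|_{𝐳=𝐰}. In other words, the product field a(𝐰)_(𝐧)b(𝐰) is well defined, independent of the chosen OPE. -/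

import Mathlib

open scoped BigOperators Classical

noncomputable section

namespace OPEA

variable (K : Type*) [Field K] [CharZero K]

/-- index pairs 𝐧 = (n, n̄) ∈ K² -/
abbrev Idx := K × K

def IsInt (x : K) : Prop := ∃ k : ℤ, (k : K) = x

def IsNegInt (x : K) : Prop := ∃ k : ℤ, k < 0 ∧ (k : K) = x

/-- 𝕂̄ = {𝐧 ∈ K² | n − n̄ ∈ ℤ} -/
def Kbar (n : Idx K) : Prop := IsInt K (n.1 - n.2)

def IsIntPair (n : Idx K) : Prop := IsInt K n.1 ∧ IsInt K n.2

/-- generalized binomial coefficient C(x,k) -/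
def gchoose (x : K) (k : ℕ) : K :=
  (∏ i ∈ Finset.range k, (x - (i : K))) / (k.factorial : K)

/-- (−1)^x for x an integer image in K (and 1 otherwise) -/
def negOnePow (x : K) : K :=
  if h : ∃ k : ℤ, (k : K) = x then (-1 : K) ^ h.choose else 1

variable (M : Type*) [AddCommGroup M] [Module K M]

/-- M-valued distribution in one variable pair -/
abbrev Dist1 := Idx K → M

/-- M-valued distribution in two variable pairs -/
abbrev Dist2 := Idx K → Idx K → M

/-- M-valued distribution in r variable pairs -/
abbrev DistN (r : ℕ) := (Fin r → Idx K) → M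

/-- membership in M[[𝐳]] -/
def IsPow1 (a : Dist1 K M) : Prop := ∀ n, a n ≠ 0 → IsNegInt K n.1 ∧ IsNegInt K n.2

/-- membership in M⌊𝐳⌋ -/
def InLat1 (a : Dist1 K M) : Prop :=
  ∃ S : Finset (Idx K), ∀ n, a n ≠ 0 →
    ∃ m ∈ S, IsNegInt K (n.1 - m.1) ∧ IsNegInt K (n.2 - m.2)

/-- membership in M[[𝐳,𝐰]] -/
def IsPow2 (a : Dist2 K M) : Prop :=
  ∀ n k, a n k ≠ 0 →
    (IsNegInt K n.1 ∧ IsNegInt K n.2) ∧ (IsNegInt K k.1 ∧ IsNegInt K k.2)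

/-- membership in M⌊𝐳,𝐰⌋ -/
def InLat2 (a : Dist2 K M) : Prop :=
  ∃ S : Finset (Idx K × Idx K), ∀ n k, a n k ≠ 0 →
    ∃ m ∈ S, (IsNegInt K (n.1 - m.1.1) ∧ IsNegInt K (n.2 - m.1.2)) ∧
      (IsNegInt K (k.1 - m.2.1) ∧ IsNegInt K (k.2 - m.2.2))

/-- membership in M[[𝐳₁,…,𝐳ᵣ]] -/
def IsPowN {r : ℕ} (a : DistN K M r) : Prop :=
  ∀ n, a n ≠ 0 → ∀ i, IsNegInt K (n i).1 ∧ IsNegInt K (n i).2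

/-- membership in M⌊𝐳₁,…,𝐳ᵣ⌋ -/
def InLatN {r : ℕ} (a : DistN K M r) : Prop :=
  ∃ S : Finset (Fin r → Idx K), ∀ n, a n ≠ 0 →
    ∃ m ∈ S, ∀ i, IsNegInt K ((n i).1 - (m i).1) ∧ IsNegInt K ((n i).2 - (m i).2)

/-- ∂_z -/
def dz (a : Dist1 K M) : Dist1 K M := fun n => (-n.1) • a (n.1 - 1, n.2)

/-- ∂_z̄ -/
def dzb (a : Dist1 K M) : Dist1 K M := fun n => (-n.2) • a (n.1, n.2 - 1)

/-- ∂ in the first variable pair of a two-variable distribution (z-component) -/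
def d1z (c : Dist2 K M) : Dist2 K M := fun n k => (-n.1) • c (n.1 - 1, n.2) k

/-- ∂ in the first variable pair of a two-variable distribution (z̄-component) -/
def d1zb (c : Dist2 K M) : Dist2 K M := fun n k => (-n.2) • c (n.1, n.2 - 1) k

/-- divided power d^{(x)} of an operator d, for a K-valued exponent x
(zero unless x ∈ ℕ) -/
def dPow {A : Type*} [AddCommGroup A] [Module K A] (d : A → A) (x : K) (a : A) : A :=
  if h : ∃ j : ℕ, (j : K) = x then ((h.choose.factorial : K))⁻¹ • d^[h.choose] a else 0

/-- ∂_z^{(e_1)} ∂_z̄^{(e_2)} in the first variable pair -/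
def ddPow2 (e : Idx K) (c : Dist2 K M) : Dist2 K M :=
  dPow K (d1z K M) e.1 (dPow K (d1zb K M) e.2 c)

/-- the diagonal map c(𝐳,𝐰) ↦ c(𝐰,𝐰) -/
def diag (c : Dist2 K M) : Dist1 K M :=
  fun n => ∑ᶠ m : Idx K, c m (n.1 - m.1 - 1, n.2 - m.2 - 1)

/-- multiplication by (𝐳−𝐰)^h (expansion in z>w), on coefficients;
first index is 𝐳, second is 𝐰 -/
def zwPow (h : Idx K) (c : Dist2 K M) : Dist2 K M :=
  fun m k => ∑ᶠ i : ℕ × ℕ,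
    ((-1 : K) ^ (i.1 + i.2) * gchoose K h.1 i.1 * gchoose K h.2 i.2) •
      c (m.1 + h.1 - i.1, m.2 + h.2 - i.2) (k.1 + i.1, k.2 + i.2)

/-- multiplication by ((𝐳−𝐰)_{w>z})^h = (−1)^h (𝐰−𝐳)^h (expansion in w>z) -/
def zwPowW (h : Idx K) (c : Dist2 K M) : Dist2 K M :=
  fun m k => ∑ᶠ i : ℕ × ℕ,
    (negOnePow K (h.1 - h.2) * (-1 : K) ^ (i.1 + i.2) *
        gchoose K h.1 i.1 * gchoose K h.2 i.2) •
      c (m.1 + i.1, m.2 + i.2) (k.1 + h.1 - i.1, k.2 + h.2 - i.2)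

/-- multiplication by (𝐱+𝐰)^N of a distribution d(𝐰,𝐱) (first index 𝐰, second 𝐱);
the result is indexed by (x-index, w-index) -/
def xwPow (N : Idx K) (d : Dist2 K M) : Dist2 K M :=
  fun m k => ∑ᶠ i : ℕ × ℕ, (gchoose K N.1 i.1 * gchoose K N.2 i.2) •
    d (k.1 + i.1, k.2 + i.2) (m.1 + N.1 - i.1, m.2 + N.2 - i.2)

/-- multiplication by (𝐰+𝐱)^N of a distribution d(𝐰,𝐱) (first index 𝐰, second 𝐱);
the result is indexed by (x-index, w-index) -/
def wxPow (N : Idx K) (d : Dist2 K M) : Dist2 K M :=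
  fun m k => ∑ᶠ i : ℕ × ℕ, (gchoose K N.1 i.1 * gchoose K N.2 i.2) •
    d (k.1 + N.1 - i.1, k.2 + N.2 - i.2) (m.1 + i.1, m.2 + i.2)

/-- multiplication by 𝐱^A 𝐰^B (𝐱+𝐰)^N of p(𝐰,𝐱); result indexed (x-index, w-index) -/
def tripleXW (A B N : Idx K) (p : Dist2 K M) : Dist2 K M :=
  fun m k => ∑ᶠ l : ℕ × ℕ, (gchoose K N.1 l.1 * gchoose K N.2 l.2) •
    p (k.1 + B.1 + l.1, k.2 + B.2 + l.2) (m.1 + A.1 + N.1 - l.1, m.2 + A.2 + N.2 - l.2)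

/-- multiplication by 𝐱^A 𝐰^B (𝐰+𝐱)^N of p(𝐰,𝐱); result indexed (x-index, w-index) -/
def tripleWX (A B N : Idx K) (p : Dist2 K M) : Dist2 K M :=
  fun m k => ∑ᶠ l : ℕ × ℕ, (gchoose K N.1 l.1 * gchoose K N.2 l.2) •
    p (k.1 + B.1 + N.1 - l.1, k.2 + B.2 + N.2 - l.2) (m.1 + A.1 + l.1, m.2 + A.2 + l.2)

variable (E : Type*) [AddCommGroup E] [Module K E]

/-- End(E)-valued distributions in one variable pair -/
abbrev EDist1 := Dist1 K (Module.End K E)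

/-- End(E)-valued distributions in two variable pairs -/
abbrev EDist2 := Dist2 K (Module.End K E)

/-- End(E)-valued distributions in r variable pairs -/
abbrev EDistN (r : ℕ) := DistN K (Module.End K E) r

def ev1 (a : EDist1 K E) (v : E) : Dist1 K E := fun n => a n v

def ev2 (c : EDist2 K E) (v : E) : Dist2 K E := fun n k => c n k v

def evN {r : ℕ} (c : EDistN K E r) (v : E) : DistN K E r := fun n => c n v

/-- a(𝐳) is a field -/
def IsFieldD (a : EDist1 K E) : Prop := ∀ v, InLat1 K E (ev1 K E a v)

/-- a field in two variable pairs -/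
def IsField2D (c : EDist2 K E) : Prop := ∀ v, InLat2 K E (ev2 K E c v)

/-- the Koszul sign (−1)^{pq} -/
def koszul (p q : ZMod 2) : K := if p = 1 ∧ q = 1 then (-1 : K) else 1

/-- the data (c^i, 𝐡_i) is an OPE of the homogeneous distributions a(𝐳), b(𝐳)
of parities pa, pb (all identities to be read applied to each vector of E) -/
def IsOPE (pa pb : ZMod 2) (a b : EDist1 K E) {r : ℕ}
    (c : Fin r → EDist2 K E) (h : Fin r → Idx K) : Prop :=
  (∀ i, Kbar K (h i)) ∧ (∀ i, IsField2D K E (c i)) ∧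
  (∀ v m k, a m (b k v) = ∑ i, zwPow K E (-(h i)) (ev2 K E (c i) v) m k) ∧
  (∀ v m k, koszul K pa pb • (b k (a m v)) =
      ∑ i, zwPowW K E (-(h i)) (ev2 K E (c i) v) m k)

/-- a(𝐳), b(𝐳) (homogeneous of parities pa, pb) are local -/
def IsLocal (pa pb : ZMod 2) (a b : EDist1 K E) : Prop :=
  ∃ (r : ℕ) (c : Fin r → EDist2 K E) (h : Fin r → Idx K), IsOPE K E pa pb a b c h

/-- the exponents of an OPE are reduced: 𝐡_i ∉ 𝐡_j + ℤ² for i ≠ j -/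
def ReducedExp {r : ℕ} (h : Fin r → Idx K) : Prop :=
  ∀ i j, i ≠ j → ¬ IsIntPair K (h i - h j)

/-- the product field a(𝐰)_{(𝐧)}b(𝐰) built from an OPE (c,h), applied to a vector v -/
def prodAt {r : ℕ} (c : Fin r → EDist2 K E) (h : Fin r → Idx K) (n : Idx K)
    (v : E) : Dist1 K E :=
  fun m => ∑ i, diag K E
    (ddPow2 K E ((h i).1 - 1 - n.1, (h i).2 - 1 - n.2) (ev2 K E (c i) v)) m

/-- s₁ : a(𝐳) ↦ a_{(−1,−1)}1 -/
def s1 (one : E) (a : EDist1 K E) : E := a ((-1 : K), (-1 : K)) one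

/-- the distribution d (to be thought of as a(𝐳)1) equals
Σ_{𝐢∈ℕ²} T^{(i)} T̄^{(ī)} (d_{(−1,−1)}) 𝐳^𝐢, i.e. a(𝐳) is creative -/
def CreativeD (T Tb : Module.End K E) (d : Dist1 K E) : Prop :=
  (∀ i : ℕ × ℕ, d (-(i.1 : K) - 1, -(i.2 : K) - 1) =
      ((i.1.factorial : K)⁻¹ * (i.2.factorial : K)⁻¹) •
        ((T ^ i.1) * (Tb ^ i.2)) (d ((-1 : K), (-1 : K)))) ∧
  (∀ n : Idx K, (¬ ∃ i : ℕ × ℕ, n = (-(i.1 : K) - 1, -(i.2 : K) - 1)) → d n = 0)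

/-- a(𝐳) is translation covariant for (T, T̄) -/
def TransCov (T Tb : Module.End K E) (a : EDist1 K E) : Prop :=
  (∀ n : Idx K, T * a n - a n * T = (-n.1) • a (n.1 - 1, n.2)) ∧
  (∀ n : Idx K, Tb * a n - a n * Tb = (-n.2) • a (n.1, n.2 - 1))

/-- translation covariance of a product field, per vector -/
def TransCovAt (T Tb : Module.End K E) (P : E → Dist1 K E) : Prop :=
  (∀ v (m : Idx K), T (P v m) - P (T v) m = (-m.1) • P v (m.1 - 1, m.2)) ∧
  (∀ v (m : Idx K), Tb (P v m) - P (Tb v) m = (-m.2) • P v (m.1, m.2 - 1))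

/-- the identity field 1(z) = id_E -/
def idField : EDist1 K E :=
  fun n => if n = ((-1 : K), (-1 : K)) then (1 : Module.End K E) else 0

/-- pairs i < j in [r] -/
abbrev Pairs (r : ℕ) := {p : Fin r × Fin r // p.1 < p.2}

/-- the index shift of the i-th variable produced by the monomial of a binomial
expansion of ((𝐳_{p₁} − 𝐳_{p₂})_σ)^h belonging to 𝐤 ∈ ℕ² -/
def pairShift {r : ℕ} (p : Pairs r) (h : Idx K) (flip : Bool) (kk : ℕ × ℕ)
    (i : Fin r) : Idx K :=
  if i = p.1.1 then
    (if flip then ((kk.1 : K), (kk.2 : K)) else (h.1 - kk.1, h.2 - kk.2))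
  else if i = p.1.2 then
    (if flip then (h.1 - kk.1, h.2 - kk.2) else ((kk.1 : K), (kk.2 : K)))
  else 0

/-- the coefficient of a binomial expansion of ((𝐳_{p₁} − 𝐳_{p₂})_σ)^h
belonging to 𝐤 ∈ ℕ² -/
def pairCoef (h : Idx K) (flip : Bool) (kk : ℕ × ℕ) : K :=
  (if flip then negOnePow K (h.1 - h.2) else 1) * (-1 : K) ^ (kk.1 + kk.2) *
    gchoose K h.1 kk.1 * gchoose K h.2 kk.2

def flipOf {r : ℕ} (σ : Equiv.Perm (Fin r)) (p : Pairs r) : Bool :=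
  decide (σ.symm p.1.2 < σ.symm p.1.1)

/-- multiplication by Π_{i<j} ((𝐳_i − 𝐳_j)_σ)^{h_{ij}} on an r-variable distribution -/
def permMul {r : ℕ} (σ : Equiv.Perm (Fin r)) (hs : Pairs r → Idx K)
    (c : DistN K M r) : DistN K M r :=
  fun m => ∑ᶠ κ : Pairs r → ℕ × ℕ,
    (∏ p : Pairs r, pairCoef K (hs p) (flipOf σ p) (κ p)) •
      c (fun i => m i + ∑ p : Pairs r, pairShift K p (hs p) (flipOf σ p) (κ p) i)

/-- the Koszul sign ζ' produced by reordering a¹,…,aʳ into a^{σ1},…,a^{σr} -/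
def koszulPerm {r : ℕ} (ps : Fin r → ZMod 2) (σ : Equiv.Perm (Fin r)) : K :=
  ∏ p : Pairs r,
    if σ.symm p.1.2 < σ.symm p.1.1 ∧ ps p.1.1 = 1 ∧ ps p.1.2 = 1 then (-1 : K) else 1

/-- the composition a^{σ1}(𝐳_{σ1})_{m_{σ1}} ∘ ⋯ ∘ a^{σr}(𝐳_{σr})_{m_{σr}} applied to v -/
def compSeq {r : ℕ} (a : Fin r → EDist1 K E) (σ : Equiv.Perm (Fin r))
    (m : Fin r → Idx K) (v : E) : E :=
  (List.ofFn fun j : Fin r => σ j).foldr (fun i acc => a i (m i) acc) v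

/-- the data (c^α, 𝐡_{ij}^k) is a (multiple) OPE of the homogeneous distributions
a¹(𝐳),…,aʳ(𝐳) of parities ps -/
def IsMultOPE {r : ℕ} (a : Fin r → EDist1 K E) (ps : Fin r → ZMod 2)
    (rij : Fin r → Fin r → ℕ) (hs : ∀ i j : Fin r, Fin (rij i j) → Idx K)
    (c : ((p : Pairs r) → Fin (rij p.1.1 p.1.2)) → EDistN K E r) : Prop :=
  (∀ i j k, Kbar K (hs i j k)) ∧
  (∀ α v, InLatN K E (evN K E (c α) v)) ∧
  (∀ σ : Equiv.Perm (Fin r), ∀ v m,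
    koszulPerm K ps σ • compSeq K E a σ m v =
      ∑ α : (p : Pairs r) → Fin (rij p.1.1 p.1.2),
        permMul K E σ (fun p => -(hs p.1.1 p.1.2 (α p))) (evN K E (c α) v) m)

/-- a¹(𝐳),…,aʳ(𝐳) are multiply local -/
def MultiplyLocal {r : ℕ} (a : Fin r → EDist1 K E) (ps : Fin r → ZMod 2) : Prop :=
  ∃ (rij : Fin r → Fin r → ℕ) (hs : ∀ i j : Fin r, Fin (rij i j) → Idx K)
    (c : ((p : Pairs r) → Fin (rij p.1.1 p.1.2)) → EDistN K E r),
      IsMultOPE K E a ps rij hs c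

/-- a set of homogeneous fields (with parities pF) is multiply local -/
def MultLocalSet (F : Set (EDist1 K E)) (pF : EDist1 K E → ZMod 2) : Prop :=
  ∀ (r : ℕ) (f : Fin r → EDist1 K E), (∀ i, f i ∈ F) →
    MultiplyLocal K E f (fun i => pF (f i))

/-- a set of homogeneous fields (with parities pF) is uniformly local -/
def UnifLocalSet (F : Set (EDist1 K E)) (pF : EDist1 K E → ZMod 2) (one : E) : Prop :=
  ∃ (rr : EDist1 K E → EDist1 K E → ℕ)
    (hh : ∀ d e : EDist1 K E, Fin (rr d e) → Idx K),
    ∀ (r : ℕ) (f : Fin r → EDist1 K E), (∀ i, f i ∈ F) →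
      ∃ c, IsMultOPE K E f (fun i => pF (f i)) (fun i j => rr (f i) (f j))
          (fun i j => hh (f i) (f j)) c ∧
        ∀ α, IsPowN K E (evN K E (c α) one)

/-- a ∈ V is homogeneous of parity p w.r.t. the grading (ev, od) -/
def memPar {V : Type*} [AddCommGroup V] [Module K V] (ev od : Submodule K V)
    (a : V) (p : ZMod 2) : Prop :=
  (p = 0 ∧ a ∈ ev) ∨ (p = 1 ∧ a ∈ od)

/-- an endomorphism is homogeneous of parity p w.r.t. the grading (ev, od) -/
def EndPar {V : Type*} [AddCommGroup V] [Module K V] (ev od : Submodule K V)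
    (f : Module.End K V) (p : ZMod 2) : Prop :=
  if p = 0 then (∀ v ∈ ev, f v ∈ ev) ∧ (∀ v ∈ od, f v ∈ od)
  else (∀ v ∈ ev, f v ∈ od) ∧ (∀ v ∈ od, f v ∈ ev)

/-- a distribution is homogeneous of parity p -/
def EDistPar {V : Type*} [AddCommGroup V] [Module K V] (ev od : Submodule K V)
    (a : EDist1 K V) (p : ZMod 2) : Prop :=
  ∀ n, EndPar K ev od (a n) p

end OPEA

namespace OPEA

/-- an OPE-algebra -/
structure OPEAlg (K : Type*) [Field K] [CharZero K]
    (V : Type*) [AddCommGroup V] [Module K V] where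
  ev : Submodule K V
  od : Submodule K V
  compl : IsCompl ev od
  Y : V →ₗ[K] EDist1 K V
  Y_par : ∀ a p, memPar K ev od a p → ∀ (n : Idx K) b q, memPar K ev od b q →
    memPar K ev od (Y a n b) (p + q)
  one : V
  one_ev : one ∈ ev
  T : Module.End K V
  Tb : Module.End K V
  T_ev : EndPar K ev od T 0
  Tb_ev : EndPar K ev od Tb 0
  commTTb : T * Tb = Tb * T
  T_one : T one = 0
  Tb_one : Tb one = 0
  wcre : ∀ a, IsPow1 K V (ev1 K V (Y a) one)
  rid : ∀ a, Y a ((-1 : K), (-1 : K)) one = a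
  tcov : ∀ a, TransCov K V T Tb (Y a)
  loc : ∀ a b pa pb, memPar K ev od a pa → memPar K ev od b pb →
    IsLocal K V pa pb (Y a) (Y b)

/-- a bounded 𝕂̄-fold algebra -/
structure BFold (K : Type*) [Field K] [CharZero K]
    (V : Type*) [AddCommGroup V] [Module K V] where
  ev : Submodule K V
  od : Submodule K V
  compl : IsCompl ev od
  Y : V →ₗ[K] EDist1 K V
  Y_par : ∀ a p, memPar K ev od a p → ∀ (n : Idx K) b q, memPar K ev od b q →
    memPar K ev od (Y a n b) (p + q)
  fields : ∀ a, IsFieldD K V (Y a)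
  bounded : ∀ a (n : Idx K), ¬ Kbar K n → ∀ b, Y a n b = 0

/-- a bounded 𝕂̄-fold module over a bounded 𝕂̄-fold algebra -/
structure BMod (K : Type*) [Field K] [CharZero K]
    (V : Type*) [AddCommGroup V] [Module K V] (A : BFold K V)
    (Mo : Type*) [AddCommGroup Mo] [Module K Mo] where
  evM : Submodule K Mo
  odM : Submodule K Mo
  complM : IsCompl evM odM
  YM : V →ₗ[K] EDist1 K Mo
  YM_par : ∀ a p, memPar K A.ev A.od a p → ∀ n : Idx K, EndPar K evM odM (YM a n) p
  fieldsM : ∀ a, IsFieldD K Mo (YM a)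
  boundedM : ∀ a (n : Idx K), ¬ Kbar K n → ∀ c, YM a n c = 0

variable (K : Type*) [Field K] [CharZero K]
variable (V : Type*) [AddCommGroup V] [Module K V]
variable (Mo : Type*) [AddCommGroup Mo] [Module K Mo]

/-- the operator T₁ : a ↦ a_{(−2,−1)}1 of an OPE-algebra -/
def T1 (A : OPEAlg K V) : Module.End K V where
  toFun := fun a => A.Y a ((-2 : K), (-1 : K)) A.one
  map_add' := by
    intro x y
    simp [map_add, Pi.add_apply, LinearMap.add_apply]
  map_smul' := by
    intro c x
    simp [map_smul, Pi.smul_apply, LinearMap.smul_apply]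

/-- the operator T̄₁ : a ↦ a_{(−1,−2)}1 of an OPE-algebra -/
def T1b (A : OPEAlg K V) : Module.End K V where
  toFun := fun a => A.Y a ((-1 : K), (-2 : K)) A.one
  map_add' := by
    intro x y
    simp [map_add, Pi.add_apply, LinearMap.add_apply]
  map_smul' := by
    intro c x
    simp [map_smul, Pi.smul_apply, LinearMap.smul_apply]

/-- skew-symmetry for the pair (T, T̄) -/
def SkewSym (ev od : Submodule K V) (Yf : V → EDist1 K V)
    (T Tb : Module.End K V) : Prop :=
  ∀ a b pa pb, memPar K ev od a pa → memPar K ev od b pb →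
    ∀ n : Idx K, Kbar K n →
      (Function.support (fun i : ℕ × ℕ =>
        ((i.1.factorial : K)⁻¹ * (i.2.factorial : K)⁻¹ *
            negOnePow K (n.1 + i.1 - (n.2 + i.2))) •
          ((T ^ i.1) * (Tb ^ i.2)) (Yf a (n.1 + i.1, n.2 + i.2) b))).Finite ∧
      koszul K pa pb • Yf b n a =
        ∑ᶠ i : ℕ × ℕ, ((i.1.factorial : K)⁻¹ * (i.2.factorial : K)⁻¹ *
            negOnePow K (n.1 + i.1 - (n.2 + i.2))) •
          ((T ^ i.1) * (Tb ^ i.2)) (Yf a (n.1 + i.1, n.2 + i.2) b)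

/-- (T, T̄) is a translation endomorphism of the module with state-field map YM -/
def TransEnd (YM : V → EDist1 K Mo) (T Tb : Module.End K V) : Prop :=
  (∀ a (n : Idx K), YM (T a) n = (-n.1) • YM a (n.1 - 1, n.2)) ∧
  (∀ a (n : Idx K), YM (Tb a) n = (-n.2) • YM a (n.1, n.2 - 1))

/-- the coefficient at (x-index m, w-index k) of a(𝐱+𝐰) applied to the w-distribution bw -/
def lhsXW (YM : V → EDist1 K Mo) (a : V) (bw : Dist1 K Mo) (m k : Idx K) : Mo :=
  ∑ᶠ i : ℕ × ℕ, ((i.1.factorial : K)⁻¹ * (i.2.factorial : K)⁻¹) •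
    (((dz K (Module.End K Mo))^[i.1] ((dzb K (Module.End K Mo))^[i.2] (YM a))) m)
      (bw (k.1 + i.1, k.2 + i.2))

/-- a and cM are dual in the direct channel -/
def DualDirect (Y : V → EDist1 K V) (YM : V → EDist1 K Mo) (a : V) (cM : Mo) : Prop :=
  ∃ (s : ℕ) (d : Fin s → Idx K → Idx K → (V →ₗ[K] Mo)) (hj : Fin s → Idx K),
    (∀ j, Kbar K (hj j)) ∧
    (∀ j b, InLat2 K Mo (fun kw mx => d j kw mx b)) ∧
    (∀ b (m k : Idx K),
      lhsXW K V Mo YM a (fun k' => YM b k' cM) m k =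
        ∑ j, xwPow K Mo (-(hj j)) (fun kw mx => d j kw mx b) m k) ∧
    (∀ b (m k : Idx K),
      YM (Y a m b) k cM =
        ∑ j, wxPow K Mo (-(hj j)) (fun kw mx => d j kw mx b) m k)

/-- a and b are dual in the exchange channel on the module -/
def DualExch (Y : V → EDist1 K V) (YM : V → EDist1 K Mo) (a b : V) : Prop :=
  ∃ (r : ℕ) (hab : Fin r → Idx K), (∀ i, Kbar K (hab i)) ∧
    ∀ cM : Mo, ∃ (s : ℕ) (hac : Fin s → Idx K)
      (q : Fin r → Fin s → Idx K → Idx K → Mo),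
      (∀ j, Kbar K (hac j)) ∧
      (∀ i j kw mx, q i j kw mx ≠ 0 → IsNegInt K mx.1 ∧ IsNegInt K mx.2) ∧
      (∀ i j mx, InLat1 K Mo (fun kw => q i j kw mx)) ∧
      (∀ m k : Idx K,
        lhsXW K V Mo YM a (fun k' => YM b k' cM) m k =
          ∑ j, xwPow K Mo (-(hac j))
            (fun kw mx => ∑ i, q i j kw (mx.1 - (hab i).1, mx.2 - (hab i).2)) m k) ∧
      (∀ m k : Idx K,
        YM (Y a m b) k cM =
          ∑ j, wxPow K Mo (-(hac j))
            (fun kw mx => ∑ i, q i j kw (mx.1 - (hab i).1, mx.2 - (hab i).2)) m k)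

/-- the module with state-field map YM is dual -/
def IsDualMod (ev od : Submodule K V) (Y : V → EDist1 K V) (YM : V → EDist1 K Mo) : Prop :=
  ∃ (rVV : V → V → ℕ) (hVV : ∀ a b : V, Fin (rVV a b) → Idx K)
    (rVM : V → Mo → ℕ) (hVM : ∀ (a : V) (c : Mo), Fin (rVM a c) → Idx K),
    (∀ a b i, Kbar K (hVV a b i)) ∧ (∀ a c j, Kbar K (hVM a c j)) ∧
    ∀ a b pa pb, memPar K ev od a pa → memPar K ev od b pb → ∀ c : Mo,
      ∃ p : Fin (rVV a b) → Fin (rVM a c) → Fin (rVM b c) → Dist2 K Mo,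
        (∀ i j k, IsPow2 K Mo (p i j k)) ∧
        (∀ m k : Idx K,
          lhsXW K V Mo YM a (fun k' => YM b k' c) m k =
            ∑ i, ∑ j, ∑ kk, tripleXW K Mo (-(hVV a b i)) (-(hVM b c kk))
              (-(hVM a c j)) (p i j kk) m k) ∧
        (∀ m k : Idx K,
          YM (Y a m b) k c =
            ∑ i, ∑ j, ∑ kk, tripleWX K Mo (-(hVV a b i)) (-(hVM b c kk))
              (-(hVM a c j)) (p i j kk) m k)

/-- F_Y is multiply local -/
def MultLocalAlg (A : OPEAlg K V) : Prop :=
  ∀ (r : ℕ) (f : Fin r → V) (pf : Fin r → ZMod 2),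
    (∀ i, memPar K A.ev A.od (f i) (pf i)) →
      MultiplyLocal K V (fun i => A.Y (f i)) pf

/-- F_Y is uniformly local -/
def UnifLocalAlg (A : OPEAlg K V) : Prop :=
  ∃ (rr : V → V → ℕ) (hh : ∀ a b : V, Fin (rr a b) → Idx K),
    ∀ (r : ℕ) (f : Fin r → V) (pf : Fin r → ZMod 2),
      (∀ i, memPar K A.ev A.od (f i) (pf i)) →
        ∃ c, IsMultOPE K V (fun i => A.Y (f i)) pf (fun i j => rr (f i) (f j))
            (fun i j => hh (f i) (f j)) c ∧
          ∀ α, IsPowN K V (evN K V (c α) A.one)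

end OPEA
namespace OPEA

open Polynomial in
/-- If `Q / P` solves `(1 - X) derivative y = -c y`, then `c` is an integer. -/
lemma isInt_of_wronskian_eq {K : Type*} [Field K] [CharZero K] {c : K} {P Q : K[X]}
    (hP : P ≠ 0) (hQ : Q ≠ 0)
    (hPQ : (1 - X) * (P * derivative Q - derivative P * Q) + C c * (P * Q) = 0) :
    IsInt K c := by
  obtain ⟨P₁, hP₁, hP₁'⟩ := exists_eq_pow_rootMultiplicity_mul_and_not_dvd P hP 1
  obtain ⟨Q₁, hQ₁, hQ₁'⟩ := exists_eq_pow_rootMultiplicity_mul_and_not_dvd Q hQ 1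
  generalize rootMultiplicity 1 P = a at hP₁
  generalize rootMultiplicity 1 Q = b at hQ₁
  have hder : ∀ (n : ℕ) (R : K[X]), (X - C 1) * derivative ((X - C 1) ^ n * R) =
      (X - C 1) ^ n * ((n : K[X]) * R + (X - C 1) * derivative R) := by
    intro n R
    rcases n with _ | n
    · simp
    · rw [derivative_mul, derivative_X_sub_C_pow]
      simp only [map_one, Nat.add_sub_cancel, map_natCast]
      ring
  have hdP := hder a P₁
  have hdQ := hder b Q₁
  rw [← hP₁] at hdP
  rw [← hQ₁] at hdQ
  have hX : (X - C 1 : K[X]) = X - 1 := by simp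
  rw [hX] at hP₁ hQ₁ hP₁' hQ₁' hdP hdQ
  have key : (X - 1 : K[X]) ^ (a + b) *
      (((a : K[X]) - (b : K[X]) + C c) * (P₁ * Q₁) +
        (X - 1) * (derivative P₁ * Q₁ - P₁ * derivative Q₁)) = 0 := by
    calc _ = ((X - 1) ^ b * Q₁) * ((X - 1) ^ a * ((a : K[X]) * P₁ + (X - 1) * derivative P₁))
          - ((X - 1) ^ a * P₁) * ((X - 1) ^ b * ((b : K[X]) * Q₁ + (X - 1) * derivative Q₁))
          + C c * (((X - 1) ^ a * P₁) * ((X - 1) ^ b * Q₁)) := by ring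
      _ = 0 := by
        rw [← hdP, ← hdQ, ← hP₁, ← hQ₁]
        linear_combination hPQ
  have hX0 : (X - 1 : K[X]) ≠ 0 := by simpa using X_sub_C_ne_zero (1 : K)
  have key' := (mul_eq_zero.mp key).resolve_left (pow_ne_zero _ hX0)
  have hev := congrArg (eval 1) key'
  simp only [eval_add, eval_mul, eval_sub, eval_natCast, eval_C, eval_X, eval_one, sub_self,
    zero_mul, add_zero, eval_zero] at hev
  rw [← hX, dvd_iff_isRoot, IsRoot.def] at hP₁' hQ₁'
  have hab := (mul_eq_zero.mp hev).resolve_right (mul_ne_zero hP₁' hQ₁')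
  exact ⟨(b : ℤ) - a, by push_cast; linear_combination -hab⟩

section BinomialSeries

variable {K : Type*} [Field K] [CharZero K]

lemma gchoose_zero (x : K) : gchoose K x 0 = 1 := by simp [gchoose]

lemma gchoose_succ_mul (x : K) (j : ℕ) :
    gchoose K x (j + 1) * ((j : K) + 1) = gchoose K x j * (x - j) := by
  have h1 : (j.factorial : K) ≠ 0 := by exact_mod_cast j.factorial_ne_zero
  have h2 : (j : K) + 1 ≠ 0 := by exact_mod_cast j.succ_ne_zero
  simp only [gchoose, Finset.prod_range_succ, Nat.factorial_succ]
  push_cast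
  field_simp

lemma gchoose_add_one_succ (x : K) (j : ℕ) :
    gchoose K (x + 1) (j + 1) = gchoose K x j + gchoose K x (j + 1) := by
  have h1 : (j.factorial : K) ≠ 0 := by exact_mod_cast j.factorial_ne_zero
  have h2 : (j : K) + 1 ≠ 0 := by exact_mod_cast j.succ_ne_zero
  have h3 : ∏ i ∈ Finset.range (j + 1), (x + 1 - (i : K)) =
      (∏ i ∈ Finset.range j, (x - (i : K))) * (x + 1) := by
    rw [Finset.prod_range_succ']
    simp [add_sub_add_right_eq_sub]
  simp only [gchoose, h3, Finset.prod_range_succ, Nat.factorial_succ]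
  push_cast
  field_simp
  ring

/-- the coefficients of the binomial series `(1 - X) ^ (-h)` -/
def negBinom (h : K) (j : ℕ) : K := (-1) ^ j * gchoose K (-h) j

/-- the binomial series `(1 - X) ^ (-h)` -/
def negBinomSeries (h : K) : PowerSeries K := PowerSeries.mk (negBinom h)

open PowerSeries in
lemma one_sub_X_mul_negBinomSeries (h : K) :
    (1 - X) * negBinomSeries (h + 1) = negBinomSeries h := by
  ext j
  rcases j with _ | j
  · simp [negBinomSeries, negBinom, gchoose_zero, sub_mul]
  · have := gchoose_add_one_succ (-(h + 1)) j
    rw [show -(h + 1) + 1 = -h by ring] at this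
    simp only [negBinomSeries, negBinom, sub_mul, one_mul, map_sub, coeff_succ_X_mul,
      coeff_mk, this]
    ring

open PowerSeries in
lemma negBinomSeries_sub_natCast (h : K) (l : ℕ) :
    negBinomSeries (h - l) = (1 - X) ^ l * negBinomSeries h := by
  induction l with
  | zero => simp
  | succ l ih =>
    rw [← one_sub_X_mul_negBinomSeries,
      show h - ((l + 1 : ℕ) : K) + 1 = h - l by push_cast; ring, ih]
    ring

open PowerSeries in
lemma one_sub_X_mul_derivative_negBinomSeries (h : K) :
    (1 - X) * derivative K (negBinomSeries h) = C h * negBinomSeries h := by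
  ext j
  have key : ∀ j : ℕ, negBinom h (j + 1) * ((j : K) + 1) = negBinom h j * (h + j) := by
    intro j
    simp only [negBinom]
    linear_combination (-1) ^ (j + 1) * gchoose_succ_mul (-h) j
  rcases j with _ | j
  · have := key 0
    simp only [negBinomSeries, sub_mul, one_mul, map_sub, coeff_zero_X_mul, coeff_derivative,
      coeff_mk, coeff_C_mul]
    push_cast at this ⊢
    linear_combination this
  · have := key (j + 1)
    simp only [negBinomSeries, sub_mul, one_mul, map_sub, coeff_succ_X_mul, coeff_derivative,
      coeff_mk, coeff_C_mul]
    push_cast at this ⊢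
    linear_combination this

lemma negBinomSeries_ne_zero (h : K) : negBinomSeries h ≠ 0 := by
  intro h0
  simpa [negBinomSeries, negBinom, gchoose_zero] using congrArg (PowerSeries.coeff 0) h0

open Polynomial in
/-- Binomial series whose exponents are pairwise incongruent modulo `ℤ` are linearly independent
over the polynomials. -/
lemma eq_zero_of_sum_mul_negBinomSeries_eq_zero (T : Finset K)
    (hT : ∀ x ∈ T, ∀ y ∈ T, IsInt K (x - y) → x = y) (P : K → K[X])
    (hP : ∑ x ∈ T, (P x : PowerSeries K) * negBinomSeries x = 0) : ∀ x ∈ T, P x = 0 := by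
  induction T using Finset.induction_on generalizing P with
  | empty => simp
  | insert x₀ T hx₀ ih =>
    have hT' : ∀ x ∈ T, ∀ y ∈ T, IsInt K (x - y) → x = y := fun x hx y hy =>
      hT x (Finset.mem_insert_of_mem hx) y (Finset.mem_insert_of_mem hy)
    have hP0 : P x₀ = 0 := by
      by_contra hne
      have hall : ∀ x ∈ T, P x = 0 := by
        have hder := congrArg (fun f => (1 - PowerSeries.X) * PowerSeries.derivative K f) hP
        simp only [map_sum, Derivation.leibniz, smul_eq_mul, Finset.mul_sum, map_zero,
          mul_zero] at hder
        have hder' : ∑ x ∈ insert x₀ T,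
            ((((1 - X) * derivative (P x) + C x * P x : K[X])) : PowerSeries K) *
              negBinomSeries x = 0 := by
          rw [← hder]
          refine Finset.sum_congr rfl fun x _ => ?_
          rw [PowerSeries.derivative_coe]
          push_cast
          linear_combination -(P x : PowerSeries K) * one_sub_X_mul_derivative_negBinomSeries x
        have hcomb := ih hT' (fun x =>
          (1 - X) * (P x₀ * derivative (P x) - derivative (P x₀) * P x)
            + C (x - x₀) * (P x₀ * P x)) (by
          rw [Finset.sum_insert hx₀] at hder' hP
          have h1 : ∀ x, ((((1 - X) * (P x₀ * derivative (P x) - derivative (P x₀) * P x)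
            + C (x - x₀) * (P x₀ * P x) : K[X])) : PowerSeries K) * negBinomSeries x =
              (P x₀ : PowerSeries K) *
                (((((1 - X) * derivative (P x) + C x * P x : K[X])) : PowerSeries K) *
                  negBinomSeries x)
              - ((((1 - X) * derivative (P x₀) + C x₀ * P x₀ : K[X])) : PowerSeries K) *
                ((P x : PowerSeries K) * negBinomSeries x) := by
            intro x
            push_cast [map_sub]
            ring
          simp only [h1, Finset.sum_sub_distrib, ← Finset.mul_sum]
          linear_combination (P x₀ : PowerSeries K) * hder' -
            ((((1 - X) * derivative (P x₀) + C x₀ * P x₀ : K[X])) : PowerSeries K) * hP)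
        intro x hx
        by_contra hPx
        have hint := isInt_of_wronskian_eq hne hPx (hcomb x hx)
        exact hx₀ (hT x (Finset.mem_insert_of_mem hx) x₀ (Finset.mem_insert_self _ _) hint ▸ hx)
      rw [Finset.sum_insert hx₀, Finset.sum_eq_zero (fun x hx => by simp [hall x hx]),
        add_zero] at hP
      have := (mul_eq_zero.mp hP).resolve_right (negBinomSeries_ne_zero x₀)
      exact hne (by exact_mod_cast this)
    rw [Finset.sum_insert hx₀, hP0] at hP
    intro x hx
    rcases Finset.mem_insert.mp hx with rfl | hx
    · exact hP0
    · exact ih hT' P (by simpa using hP) x hx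

end BinomialSeries

section NatExt

variable {K : Type*} [Field K]

/-- a sequence, extended by zero from `ℕ` to `K` -/
def natExt (x : K) (f : ℕ → K) : K := if h : ∃ j : ℕ, (j : K) = x then f h.choose else 0

lemma natExt_of_not {x : K} (h : ¬ ∃ j : ℕ, (j : K) = x) (f : ℕ → K) : natExt x f = 0 := by
  rw [natExt, dif_neg h]

/-- a representative of the class of `x` modulo `ℤ` -/
def intRep (x : K) : K :=
  (QuotientAddGroup.mk x : K ⧸ (Int.castAddHom K).range).out

lemma isInt_sub_intRep (x : K) : IsInt K (x - intRep x) := by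
  have h := QuotientAddGroup.eq.mp
    (QuotientAddGroup.out_eq' (QuotientAddGroup.mk x : K ⧸ (Int.castAddHom K).range))
  obtain ⟨k, hk⟩ := h
  refine ⟨k, ?_⟩
  simp only [Int.coe_castAddHom] at hk
  rw [hk, intRep]
  ring

lemma intRep_eq_of_isInt_sub {x y : K} (h : IsInt K (x - y)) : intRep x = intRep y := by
  obtain ⟨k, hk⟩ := h
  have : (QuotientAddGroup.mk x : K ⧸ (Int.castAddHom K).range) = QuotientAddGroup.mk y := by
    rw [eq_comm, QuotientAddGroup.eq]
    exact ⟨k, by simp only [Int.coe_castAddHom]; rw [hk]; ring⟩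
  rw [intRep, this, intRep]

lemma exists_natCast_bound (T : Finset K) :
    ∃ N : ℕ, ∀ x ∈ T, ∃ l : ℕ, x = intRep x + N - l := by
  choose z hz using fun x : K => isInt_sub_intRep x
  refine ⟨∑ x ∈ T, (z x).natAbs, fun x hx => ?_⟩
  have h : (z x).natAbs ≤ ∑ x ∈ T, (z x).natAbs :=
    Finset.single_le_sum (f := fun x => (z x).natAbs) (fun _ _ => Nat.zero_le _) hx
  obtain ⟨l, hl⟩ := Int.eq_ofNat_of_zero_le
    (a := ((∑ x ∈ T, (z x).natAbs : ℕ) : ℤ) - z x) (by omega)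
  refine ⟨l, ?_⟩
  have hl' := congrArg (Int.cast : ℤ → K) hl
  simp only [Int.cast_sub, Int.cast_natCast] at hl'
  linear_combination -hl' - hz x

variable [CharZero K]

lemma natExt_natCast (j : ℕ) (f : ℕ → K) : natExt (j : K) f = f j := by
  have h : ∃ i : ℕ, (i : K) = j := ⟨j, rfl⟩
  rw [natExt, dif_pos h, Nat.cast_injective h.choose_spec]

lemma natExt_natCast_sub_natCast (a b : ℕ) (f : ℕ → K) :
    natExt ((a : K) - b) f = if b ≤ a then f (a - b) else 0 := by
  split_ifs with h
  · rw [← Nat.cast_sub h, natExt_natCast]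
  · refine natExt_of_not ?_ f
    rintro ⟨j, hj⟩
    have : j + b = a := by exact_mod_cast (eq_sub_iff_add_eq.mp hj)
    omega

open Polynomial in
/-- A relation between the functions `X ^ k (1 - X) ^ (l - η)`, expanded at `0`, persists for
their expansions at `1`, within each class of exponents modulo `ℤ`. -/
lemma sum_mul_coeff_eq_zero {ι : Type*} (S : Finset ι) (u η : ι → K) (k l : ι → ℕ)
    (hη : ∀ i ∈ S, ∀ j ∈ S, IsInt K (η i - η j) → η i = η j)
    (hS : ∑ i ∈ S, PowerSeries.C (u i) * (PowerSeries.X ^ k i * negBinomSeries (η i - l i)) = 0)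
    (η₀ β : K) (e : ℕ) :
    ∑ i ∈ S with η i = η₀,
      u i * PowerSeries.coeff e (PowerSeries.X ^ l i * negBinomSeries (β - k i)) = 0 := by
  set P : K → K[X] := fun x => ∑ i ∈ S with η i = x, C (u i) * (X ^ k i * (1 - X) ^ l i) with hP
  have hcoe : ∀ x, (P x : PowerSeries K) = ∑ i ∈ S with η i = x,
      PowerSeries.C (u i) * (PowerSeries.X ^ k i * (1 - PowerSeries.X) ^ l i) := by
    intro x
    rw [hP, ← Polynomial.coeToPowerSeries.ringHom_apply, map_sum]
    simp
  have hzero := eq_zero_of_sum_mul_negBinomSeries_eq_zero (S.image η) (by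
      intro x hx y hy hxy
      obtain ⟨i, hi, rfl⟩ := Finset.mem_image.mp hx
      obtain ⟨j, hj, rfl⟩ := Finset.mem_image.mp hy
      exact hη i hi j hj hxy) P (by
    rw [← hS, ← Finset.sum_fiberwise_of_maps_to (fun i hi => Finset.mem_image_of_mem η hi)]
    refine Finset.sum_congr rfl fun x _ => ?_
    rw [hcoe, Finset.sum_mul]
    refine Finset.sum_congr rfl fun i hi => ?_
    rw [negBinomSeries_sub_natCast, (Finset.mem_filter.mp hi).2]
    ring)
  by_cases hmem : η₀ ∈ S.image η
  · have h2 : ∑ i ∈ S with η i = η₀,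
        PowerSeries.C (u i) * ((1 - PowerSeries.X) ^ k i * PowerSeries.X ^ l i) = 0 := by
      rw [← map_zero (coeToPowerSeries.ringHom.comp (compRingHom (1 - X))), ← hzero η₀ hmem, hP,
        map_sum]
      simp
    have h3 := congrArg (fun f => PowerSeries.coeff e (f * negBinomSeries β)) h2
    simp only [zero_mul, map_zero, Finset.sum_mul, map_sum] at h3
    rw [← h3]
    refine Finset.sum_congr rfl fun i _ => ?_
    rw [← PowerSeries.coeff_C_mul, negBinomSeries_sub_natCast]
    congr 1
    ring
  · refine Finset.sum_eq_zero fun i hi => ?_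
    rw [Finset.mem_filter] at hi
    exact absurd (hi.2 ▸ Finset.mem_image_of_mem η hi.1) hmem

lemma sum_mul_natExt_eq_zero {ι : Type*} (S : Finset ι) (u h q : ι → K)
    (hS : ∀ L : K, ∑ i ∈ S, u i * natExt (q i - L) (negBinom (h i)) = 0) (n m : K) :
    ∑ i ∈ S, u i * natExt (h i - 1 - n) (negBinom (q i + 1 - m)) = 0 := by
  obtain ⟨N, hN⟩ := exists_natCast_bound (S.image h ∪ S.image q ∪ {n + 1})
  have hNh : ∀ i, ∃ l : ℕ, i ∈ S → h i = intRep (h i) + N - l := fun i => by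
    by_cases hi : i ∈ S
    · obtain ⟨l, hl⟩ := hN (h i) (by simp [Finset.mem_image_of_mem h hi])
      exact ⟨l, fun _ => hl⟩
    · exact ⟨0, fun h => absurd h hi⟩
  have hNq : ∀ i, ∃ l : ℕ, i ∈ S → q i = intRep (q i) + N - l := fun i => by
    by_cases hi : i ∈ S
    · obtain ⟨l, hl⟩ := hN (q i) (by simp [Finset.mem_image_of_mem q hi])
      exact ⟨l, fun _ => hl⟩
    · exact ⟨0, fun h => absurd h hi⟩
  obtain ⟨e, he⟩ := hN (n + 1) (by simp)
  choose l hl using hNh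
  choose k hk using hNq
  rw [← Finset.sum_fiberwise_of_maps_to
    (fun i hi => Finset.mem_image_of_mem (fun i => intRep (q i)) hi)]
  refine Finset.sum_eq_zero fun κ hκ => ?_
  obtain ⟨i₀, _, rfl⟩ := Finset.mem_image.mp hκ
  clear hκ
  set κ := intRep (q i₀)
  have key := sum_mul_coeff_eq_zero (S.filter fun i => intRep (q i) = κ) u
    (fun i => intRep (h i) + N) k l (by
      intro i _ j _ hij
      have hij' : IsInt K (intRep (h i) - intRep (h j)) := by
        simpa [add_sub_add_right_eq_sub] using hij
      have : IsInt K (h i - h j) := by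
        obtain ⟨a, ha⟩ := isInt_sub_intRep (h i)
        obtain ⟨b, hb⟩ := isInt_sub_intRep (h j)
        obtain ⟨d, hd⟩ := hij'
        exact ⟨a - b + d, by push_cast; linear_combination ha - hb + hd⟩
      simp only [intRep_eq_of_isInt_sub this]) (by
      ext j
      rw [map_sum, map_zero, ← hS (κ + N - j), Finset.sum_filter]
      refine Finset.sum_congr rfl fun i hi => ?_
      split_ifs with hκ
      · rw [PowerSeries.coeff_C_mul, ← hl i hi, PowerSeries.coeff_X_pow_mul',
          hk i hi, hκ, show κ + N - k i - (κ + N - j) = (j : K) - k i by ring,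
          natExt_natCast_sub_natCast]
        simp [negBinomSeries]
      · rw [natExt_of_not, mul_zero]
        rintro ⟨a, ha⟩
        obtain ⟨b, hb⟩ := isInt_sub_intRep (q i₀)
        exact hκ (intRep_eq_of_isInt_sub
          ⟨a + N - j - b, by push_cast; linear_combination ha - hb⟩))
    (intRep (n + 1) + N) (κ + N + 1 - m) e
  rw [← key, Finset.sum_filter (fun i => intRep (h i) + N = intRep (n + 1) + N)]
  refine Finset.sum_congr rfl fun i hi => ?_
  obtain ⟨hi, hκ⟩ := Finset.mem_filter.mp hi
  split_ifs with hη
  · rw [show h i - 1 - n = (e : K) - l i by linear_combination hl i hi - he + hη,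
      natExt_natCast_sub_natCast, PowerSeries.coeff_X_pow_mul',
      show κ + N + 1 - m - k i = q i + 1 - m by rw [hk i hi, hκ]; ring]
    simp [negBinomSeries]
  · rw [natExt_of_not, mul_zero]
    rintro ⟨a, ha⟩
    exact hη (by rw [intRep_eq_of_isInt_sub (y := n + 1) ⟨a, by push_cast; linear_combination ha⟩])

lemma sum_natExt_smul_eq_zero {E : Type*} [AddCommGroup E] [Module K E] {ι : Type*}
    (S : Finset ι) (u : ι → E) (h q : ι → K)
    (hS : ∀ L : K, ∑ i ∈ S, natExt (q i - L) (negBinom (h i)) • u i = 0) (n m : K) :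
    ∑ i ∈ S, natExt (h i - 1 - n) (negBinom (q i + 1 - m)) • u i = 0 := by
  rw [← Module.forall_dual_apply_eq_zero_iff K]
  intro φ
  have := sum_mul_natExt_eq_zero S (fun i => φ (u i)) h q (fun L => by
    have := congrArg φ (hS L)
    simpa [map_sum, mul_comm] using this) n m
  simpa [map_sum, mul_comm] using this

lemma sum_natExt_smul_eq_zero₂ {E : Type*} [AddCommGroup E] [Module K E] {ι : Type*}
    (S : Finset ι) (u : ι → E) (h q : ι → Idx K)
    (hS : ∀ L : Idx K, ∑ i ∈ S, (natExt ((q i).1 - L.1) (negBinom (h i).1) *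
      natExt ((q i).2 - L.2) (negBinom (h i).2)) • u i = 0) (n m : Idx K) :
    ∑ i ∈ S, (natExt ((h i).1 - 1 - n.1) (negBinom ((q i).1 + 1 - m.1)) *
      natExt ((h i).2 - 1 - n.2) (negBinom ((q i).2 + 1 - m.2))) • u i = 0 := by
  have h1 := fun L₂ : K => sum_natExt_smul_eq_zero S
    (fun i => natExt ((q i).2 - L₂) (negBinom (h i).2) • u i) (fun i => (h i).1)
    (fun i => (q i).1) (fun L₁ => by simpa [smul_smul] using hS (L₁, L₂)) n.1 m.1
  have h2 := sum_natExt_smul_eq_zero S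
    (fun i => natExt ((h i).1 - 1 - n.1) (negBinom ((q i).1 + 1 - m.1)) • u i)
    (fun i => (h i).2) (fun i => (q i).2)
    (fun L₂ => by simpa [smul_smul, mul_comm] using h1 L₂) n.2 m.2
  simpa [smul_smul, mul_comm] using h2

end NatExt

section Coefficients

variable {K : Type*} [Field K] [CharZero K] {M : Type*} [AddCommGroup M]

lemma finite_isNegInt_sub_and_isNegInt_sub (D s t : K) :
    {x : K | IsNegInt K (x - s) ∧ IsNegInt K (D - x - t)}.Finite := by
  by_cases hw : ∃ w : ℤ, (w : K) = D - s - t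
  · obtain ⟨w, hw⟩ := hw
    refine ((Set.finite_Ioo w 0).image fun a : ℤ => (a : K) + s).subset ?_
    rintro x ⟨⟨a, ha, hxa⟩, ⟨b, hb, hxb⟩⟩
    refine ⟨a, ⟨?_, ha⟩, by simp only [hxa]; ring⟩
    have : a + b = w := by
      have : ((a + b : ℤ) : K) = w := by push_cast; linear_combination hxa + hxb - hw
      exact_mod_cast this
    omega
  · refine Set.finite_empty.subset ?_
    rintro x ⟨⟨a, _, hxa⟩, ⟨b, _, hxb⟩⟩
    exact hw ⟨a + b, by push_cast; linear_combination hxa + hxb⟩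

/-- An element of `M⌊𝐳,𝐰⌋` has only finitely many coefficients of a given total degree. -/
lemma InLat2.finite_ne_zero {c : Dist2 K M} (hc : InLat2 K M c) (D : Idx K) :
    {q : Idx K | c (D - q) q ≠ 0}.Finite := by
  obtain ⟨S, hS⟩ := hc
  refine (Set.Finite.biUnion S.finite_toSet fun p _ =>
    (finite_isNegInt_sub_and_isNegInt_sub D.1 p.2.1 p.1.1).prod
      (finite_isNegInt_sub_and_isNegInt_sub D.2 p.2.2 p.1.2)).subset ?_
  intro q hq
  obtain ⟨p, hp, ⟨h1, h2⟩, ⟨h3, h4⟩⟩ := hS _ _ hq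
  simp only [Set.mem_iUnion]
  exact ⟨p, hp, ⟨h3, h1⟩, ⟨h4, h2⟩⟩

variable [Module K M]

lemma zwPow_neg_eq_sum (c : Dist2 K M) (h m k : Idx K) (S : Finset (Idx K))
    (hS : ∀ q, c (m + k - h - q) q ≠ 0 → q ∈ S) :
    zwPow K M (-h) c m k = ∑ q ∈ S, (natExt (q.1 - k.1) (negBinom h.1) *
      natExt (q.2 - k.2) (negBinom h.2)) • c (m + k - h - q) q := by
  set G : Idx K → M := fun q => (natExt (q.1 - k.1) (negBinom h.1) *
      natExt (q.2 - k.2) (negBinom h.2)) • c (m + k - h - q) q with hG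
  set f : ℕ × ℕ → Idx K := fun i => (k.1 + i.1, k.2 + i.2) with hf
  have hinj : Function.Injective f := by
    rintro ⟨i, i'⟩ ⟨j, j'⟩ hij
    simpa [hf] using hij
  have hsupp : Function.support G ⊆ Set.range f := by
    intro q hq
    by_contra hqf
    apply hq
    by_cases h1 : ∃ j : ℕ, (j : K) = q.1 - k.1
    · by_cases h2 : ∃ j : ℕ, (j : K) = q.2 - k.2
      · obtain ⟨j, hj⟩ := h1
        obtain ⟨j', hj'⟩ := h2
        exact absurd ⟨(j, j'), by ext <;> simp [hf, hj, hj']⟩ hqf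
      · simp [hG, natExt_of_not h2]
    · simp [hG, natExt_of_not h1]
  rw [← finsum_eq_sum_of_support_subset G (s := S) (by
    intro q hq
    exact hS q (right_ne_zero_of_smul hq)), ← finsum_mem_univ,
    finsum_mem_inter_support_eq G Set.univ (Set.range f) (by
      rw [Set.univ_inter, Set.inter_eq_right.mpr hsupp]), finsum_mem_range hinj]
  refine finsum_congr fun i => ?_
  simp only [hG, hf, add_sub_cancel_left, natExt_natCast, negBinom]
  congr 1
  · simp only [Prod.fst_neg, Prod.snd_neg]
    ring
  · congr 1
    ext <;> simp <;> ring

lemma d1z_iterate_apply (c : Dist2 K M) (j : ℕ) (p k : Idx K) :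
    (d1z K M)^[j] c p k =
      ((-1) ^ j * ∏ i ∈ Finset.range j, (p.1 - (i : K))) • c (p.1 - j, p.2) k := by
  induction j generalizing c with
  | zero => simp
  | succ j ih =>
    rw [Function.iterate_succ_apply, ih, d1z, smul_smul, Finset.prod_range_succ]
    congr 1
    · ring
    · push_cast
      rw [sub_sub]

lemma d1zb_iterate_apply (c : Dist2 K M) (j : ℕ) (p k : Idx K) :
    (d1zb K M)^[j] c p k =
      ((-1) ^ j * ∏ i ∈ Finset.range j, (p.2 - (i : K))) • c (p.1, p.2 - j) k := by
  induction j generalizing c with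
  | zero => simp
  | succ j ih =>
    rw [Function.iterate_succ_apply, ih, d1zb, smul_smul, Finset.prod_range_succ]
    congr 1
    · ring
    · push_cast
      rw [sub_sub]

lemma dPow_natCast {A : Type*} [AddCommGroup A] [Module K A] (d : A → A) (j : ℕ) (a : A) :
    dPow K d (j : K) a = (j.factorial : K)⁻¹ • d^[j] a := by
  have h : ∃ i : ℕ, (i : K) = j := ⟨j, rfl⟩
  rw [dPow, dif_pos h, Nat.cast_injective h.choose_spec]

lemma dPow_d1z_apply (x : K) (c : Dist2 K M) (p k : Idx K) :
    dPow K (d1z K M) x c p k = natExt x (negBinom (-p.1)) • c (p.1 - x, p.2) k := by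
  by_cases hx : ∃ j : ℕ, (j : K) = x
  · obtain ⟨j, rfl⟩ := hx
    rw [dPow_natCast, natExt_natCast, Pi.smul_apply, Pi.smul_apply, d1z_iterate_apply, smul_smul]
    congr 1
    rw [negBinom, gchoose, neg_neg]
    ring
  · rw [natExt_of_not hx, dPow, dif_neg hx, zero_smul]
    rfl

lemma dPow_d1zb_apply (x : K) (c : Dist2 K M) (p k : Idx K) :
    dPow K (d1zb K M) x c p k = natExt x (negBinom (-p.2)) • c (p.1, p.2 - x) k := by
  by_cases hx : ∃ j : ℕ, (j : K) = x
  · obtain ⟨j, rfl⟩ := hx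
    rw [dPow_natCast, natExt_natCast, Pi.smul_apply, Pi.smul_apply, d1zb_iterate_apply, smul_smul]
    congr 1
    rw [negBinom, gchoose, neg_neg]
    ring
  · rw [natExt_of_not hx, dPow, dif_neg hx, zero_smul]
    rfl

lemma diag_ddPow2_eq_sum (c : Dist2 K M) (h n m : Idx K) (S : Finset (Idx K))
    (hS : ∀ q, c (m + n - h - q) q ≠ 0 → q ∈ S) :
    diag K M (ddPow2 K M (h.1 - 1 - n.1, h.2 - 1 - n.2) c) m =
      ∑ q ∈ S, (natExt (h.1 - 1 - n.1) (negBinom (q.1 + 1 - m.1)) *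
        natExt (h.2 - 1 - n.2) (negBinom (q.2 + 1 - m.2))) • c (m + n - h - q) q := by
  rw [← finsum_eq_sum_of_support_subset _ (s := S) (by
    intro q hq
    exact hS q (right_ne_zero_of_smul hq)), diag]
  refine finsum_eq_of_bijective (Equiv.subLeft (m - 1)) (Equiv.bijective _) fun p => ?_
  simp only [ddPow2, dPow_d1z_apply, dPow_d1zb_apply, smul_smul, Equiv.subLeft_apply]
  congr 1
  · congr 3 <;> simp <;> ring
  · congr 1 <;> ext <;> simp <;> ring

end Coefficients

/-- the product field a(𝐰)_(𝐧)b(𝐰) is independent of the chosen OPE. -/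
theorem stmt_0 (K : Type*) [Field K] [CharZero K]
    (E : Type*) [AddCommGroup E] [Module K E]
    (evE odE : Submodule K E) (hgr : IsCompl evE odE)
    (a b : EDist1 K E) (pa pb : ZMod 2)
    (ha : EDistPar K evE odE a pa) (hb : EDistPar K evE odE b pb)
    {r s : ℕ} (c : Fin r → EDist2 K E) (h : Fin r → Idx K)
    (d : Fin s → EDist2 K E) (g : Fin s → Idx K)
    (hch : IsOPE K E pa pb a b c h) (hdg : IsOPE K E pa pb a b d g) :
    ∀ (n : Idx K) (v : E) (m : Idx K),
      prodAt K E c h n v m = prodAt K E d g n v m := by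
  intro n v m
  obtain ⟨-, hc, hab, -⟩ := hch
  obtain ⟨-, hd, hab', -⟩ := hdg
  have hfc := fun i => (hc i v).finite_ne_zero (m + n - h i)
  have hfd := fun j => (hd j v).finite_ne_zero (m + n - g j)
  set S : Finset (Idx K) := (Set.finite_iUnion hfc).toFinset ∪ (Set.finite_iUnion hfd).toFinset
  have hSc : ∀ i q, ev2 K E (c i) v (m + n - h i - q) q ≠ 0 → q ∈ S := fun i q hq =>
    Finset.mem_union_left _ ((Set.finite_iUnion hfc).mem_toFinset.mpr
      (Set.mem_iUnion.mpr ⟨i, hq⟩))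
  have hSd : ∀ j q, ev2 K E (d j) v (m + n - g j - q) q ≠ 0 → q ∈ S := fun j q hq =>
    Finset.mem_union_right _ ((Set.finite_iUnion hfd).mem_toFinset.mpr
      (Set.mem_iUnion.mpr ⟨j, hq⟩))
  have key := sum_natExt_smul_eq_zero₂ (K := K) ((Finset.univ : Finset (Fin r ⊕ Fin s)) ×ˢ S)
    (fun p => Sum.elim (fun i => ev2 K E (c i) v (m + n - h i - p.2) p.2)
      (fun j => -ev2 K E (d j) v (m + n - g j - p.2) p.2) p.1)
    (fun p => Sum.elim h g p.1) (fun p => p.2) (fun L => by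
      have e := (hab v (m + n - L) L).symm.trans (hab' v (m + n - L) L)
      have hz : ∀ (c : Dist2 K E) (h : Idx K), (∀ q, c (m + n - h - q) q ≠ 0 → q ∈ S) →
          zwPow K E (-h) c (m + n - L) L = ∑ q ∈ S, (natExt (q.1 - L.1) (negBinom h.1) *
            natExt (q.2 - L.2) (negBinom h.2)) • c (m + n - h - q) q := fun c h hS => by
        simpa only [sub_add_cancel] using
          zwPow_neg_eq_sum c h (m + n - L) L S (by simpa only [sub_add_cancel] using hS)
      rw [Finset.sum_congr rfl fun i _ => hz _ _ (hSc i),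
        Finset.sum_congr rfl fun j _ => hz _ _ (hSd j)] at e
      rw [Finset.sum_product, Fintype.sum_sum_type]
      simp only [Sum.elim_inl, Sum.elim_inr, smul_neg, Finset.sum_neg_distrib]
      rw [e, add_neg_cancel]) n m
  rw [Finset.sum_product, Fintype.sum_sum_type] at key
  simp only [Sum.elim_inl, Sum.elim_inr, smul_neg, Finset.sum_neg_distrib] at key
  rw [prodAt, prodAt, Finset.sum_congr rfl fun i _ => diag_ddPow2_eq_sum _ (h i) n m S (hSc i),
    Finset.sum_congr rfl fun j _ => diag_ddPow2_eq_sum _ (g j) n m S (hSd j)]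
  exact add_neg_eq_zero.mp key

end OPEA
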